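/- Under the SVARM model with K ≥ 1 main-loop pairs and T̄ = 2K, for any fixed player i ∈ N and any ε > 0, assuming r_i⁺ + r_i⁻ > 0 and setting Ψ = 2ε²/(r_i⁺ + r_i⁻)², it holds that P(|φ̂_i − φ_i| ≥ ε) ≤ 2·exp(−T̄/(4Hₙ²)) + 4·exp(−Ψ·⌊T̄/(4Hₙ)⌋)/(exp(Ψ) − 1) (Theorem 4.5). -/

import Mathlib

open Finset
open scoped Classical

noncomputable section

/-- The `n`-th harmonic number `Hₙ = ∑_{k=1}^n 1/k`. -/
def harm (n : ℕ) : ℝ := ∑ k ∈ Finset.range n, (1 : ℝ) / (k + 1)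

/-- The player set `N_i = N \ {i}`. -/
def Ni (n : ℕ) (i : Fin n) : Finset (Fin n) := Finset.univ.erase i

/-- The Shapley weights `w_S = 1/(n·C(n−1,|S|))` (defining `P^w` on subsets of `N_i`). -/
def wgt (n : ℕ) (S : Finset (Fin n)) : ℝ :=
  1 / ((n : ℝ) * (Nat.choose (n - 1) S.card : ℝ))

/-- The SVARM sampling distribution `P⁺(S) = 1/(|S|·C(n,|S|)·Hₙ)` on nonempty `S ⊆ N`
(the formula evaluates to `0` on `S = ∅` by division-by-zero conventions). -/
def Pplus (n : ℕ) (S : Finset (Fin n)) : ℝ :=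
  1 / ((S.card : ℝ) * (Nat.choose n S.card : ℝ) * harm n)

/-- The SVARM sampling distribution `P⁻(S) = 1/((n−|S|)·C(n,|S|)·Hₙ)` on proper `S ⊊ N`
(the formula evaluates to `0` on `S = N` by division-by-zero conventions). -/
def Pminus (n : ℕ) (S : Finset (Fin n)) : ℝ :=
  1 / (((n : ℝ) - (S.card : ℝ)) * (Nat.choose n S.card : ℝ) * harm n)

/-- Sample space of SVARM with `K` main-loop pairs: warm-up samples `B⁺, B⁻` and main
samples `A₁⁺,…,A_K⁺`, `A₁⁻,…,A_K⁻`. -/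
abbrev Omega (n K : ℕ) :=
  Finset (Fin n) × Finset (Fin n) × (Fin K → Finset (Fin n)) × (Fin K → Finset (Fin n))

/-- Joint pmf of the mutually independent samples `B⁺, B⁻ ∼ P^w` (subsets of `N_i`),
`A₁⁺,…,A_K⁺` i.i.d. `∼ P⁺` and `A₁⁻,…,A_K⁻` i.i.d. `∼ P⁻`. -/
def jointP (n K : ℕ) (i : Fin n) (ω : Omega n K) : ℝ :=
  (if ω.1 ⊆ Ni n i then wgt n ω.1 else 0) *
    (if ω.2.1 ⊆ Ni n i then wgt n ω.2.1 else 0) *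
    (∏ k, Pplus n (ω.2.2.1 k)) * (∏ k, Pminus n (ω.2.2.2 k))

/-- Expectation with respect to the joint distribution of the SVARM samples. -/
def expVal (n K : ℕ) (i : Fin n) (f : Omega n K → ℝ) : ℝ :=
  ∑ ω : Omega n K, jointP n K i ω * f ω

/-- Probability of an event under the joint distribution of the SVARM samples. -/
def probEvent (n K : ℕ) (i : Fin n) (E : Omega n K → Prop) : ℝ :=
  ∑ ω : Omega n K, if E ω then jointP n K i ω else 0

/-- The sample count `m_i⁺ = 1 + #{k : i ∈ A_k⁺}`. -/
def mplus (n K : ℕ) (i : Fin n) (ω : Omega n K) : ℕ :=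
  1 + (Finset.univ.filter fun k => i ∈ ω.2.2.1 k).card

/-- The sample count `m_i⁻ = 1 + #{k : i ∉ A_k⁻}`. -/
def mminus (n K : ℕ) (i : Fin n) (ω : Omega n K) : ℕ :=
  1 + (Finset.univ.filter fun k => i ∉ ω.2.2.2 k).card

/-- The estimate `φ̂_i⁺ = (ν(B⁺ ∪ {i}) + ∑_{k : i ∈ A_k⁺} ν(A_k⁺))/m_i⁺`. -/
def phiHatPlus (n K : ℕ) (ν : Finset (Fin n) → ℝ) (i : Fin n) (ω : Omega n K) : ℝ :=
  (ν (insert i ω.1) + ∑ k ∈ Finset.univ.filter (fun k => i ∈ ω.2.2.1 k), ν (ω.2.2.1 k)) /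
    (mplus n K i ω : ℝ)

/-- The estimate `φ̂_i⁻ = (ν(B⁻) + ∑_{k : i ∉ A_k⁻} ν(A_k⁻))/m_i⁻`. -/
def phiHatMinus (n K : ℕ) (ν : Finset (Fin n) → ℝ) (i : Fin n) (ω : Omega n K) : ℝ :=
  (ν ω.2.1 + ∑ k ∈ Finset.univ.filter (fun k => i ∉ ω.2.2.2 k), ν (ω.2.2.2 k)) /
    (mminus n K i ω : ℝ)

/-- The SVARM estimator `φ̂_i = φ̂_i⁺ − φ̂_i⁻`. -/
def phiHat (n K : ℕ) (ν : Finset (Fin n) → ℝ) (i : Fin n) (ω : Omega n K) : ℝ :=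
  phiHatPlus n K ν i ω - phiHatMinus n K ν i ω

/-- The Shapley value `φ_i = ∑_{S ⊆ N_i} w_S (ν(S∪{i}) − ν(S))`. -/
def shapley (n : ℕ) (ν : Finset (Fin n) → ℝ) (i : Fin n) : ℝ :=
  ∑ S ∈ (Ni n i).powerset, wgt n S * (ν (insert i S) - ν S)

/-- The positive Shapley value `φ_i⁺ = E[ν(A ∪ {i})]` for `A ∼ P^w`. -/
def phiPlus (n : ℕ) (ν : Finset (Fin n) → ℝ) (i : Fin n) : ℝ :=
  ∑ S ∈ (Ni n i).powerset, wgt n S * ν (insert i S)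

/-- The negative Shapley value `φ_i⁻ = E[ν(A)]` for `A ∼ P^w`. -/
def phiMinus (n : ℕ) (ν : Finset (Fin n) → ℝ) (i : Fin n) : ℝ :=
  ∑ S ∈ (Ni n i).powerset, wgt n S * ν S

/-- The variance `σ_i⁺² = Var[ν(A ∪ {i})]` for `A ∼ P^w`. -/
def sigPlusSq (n : ℕ) (ν : Finset (Fin n) → ℝ) (i : Fin n) : ℝ :=
  ∑ S ∈ (Ni n i).powerset, wgt n S * (ν (insert i S) - phiPlus n ν i) ^ 2

/-- The variance `σ_i⁻² = Var[ν(A)]` for `A ∼ P^w`. -/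
def sigMinusSq (n : ℕ) (ν : Finset (Fin n) → ℝ) (i : Fin n) : ℝ :=
  ∑ S ∈ (Ni n i).powerset, wgt n S * (ν S - phiMinus n ν i) ^ 2

end

/-- The range `r_i⁺ = max_{S ⊆ N_i} ν(S∪{i}) − min_{S ⊆ N_i} ν(S∪{i})`. -/
noncomputable def rplus (n : ℕ) (ν : Finset (Fin n) → ℝ) (i : Fin n) : ℝ :=
  ((Ni n i).powerset.sup' ⟨∅, Finset.empty_mem_powerset _⟩ fun S => ν (insert i S)) -
    ((Ni n i).powerset.inf' ⟨∅, Finset.empty_mem_powerset _⟩ fun S => ν (insert i S))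

/-- The range `r_i⁻ = max_{S ⊆ N_i} ν(S) − min_{S ⊆ N_i} ν(S)`. -/
noncomputable def rminus (n : ℕ) (ν : Finset (Fin n) → ℝ) (i : Fin n) : ℝ :=
  ((Ni n i).powerset.sup' ⟨∅, Finset.empty_mem_powerset _⟩ fun S => ν S) -
    ((Ni n i).powerset.inf' ⟨∅, Finset.empty_mem_powerset _⟩ fun S => ν S)

/-- Hoeffding's lemma for a finite probability vector. -/
theorem sum_mul_exp_le_of_mem_Icc {α : Type*} [Fintype α] (p f : α → ℝ) (a b c l : ℝ)
    (hp : ∀ x, 0 ≤ p x) (hp1 : ∑ x, p x = 1) (hf : ∀ x, p x ≠ 0 → f x ∈ Set.Icc a b)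
    (hc : ∑ x, p x * f x = c) :
    ∑ x, p x * Real.exp (l * (f x - c)) ≤ Real.exp (l ^ 2 * (b - a) ^ 2 / 8) := by
  let _ : MeasurableSpace α := ⊤
  let μ : MeasureTheory.Measure α :=
    ∑ x, ENNReal.ofReal (p x) • MeasureTheory.Measure.dirac x
  have hμ : ∀ g : α → ℝ, ∫ x, g x ∂μ = ∑ x, p x * g x := by
    intro g
    rw [MeasureTheory.integral_finsetSum_measure]
    · simp [MeasureTheory.integral_smul_measure, hp]
    · intro x _
      exact (MeasureTheory.integrable_dirac (by simp)).smul_measure (by simp)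
  have : MeasureTheory.IsProbabilityMeasure μ := by
    constructor
    simp only [μ, MeasureTheory.Measure.coe_finsetSum, Finset.sum_apply,
      MeasureTheory.Measure.smul_apply, MeasureTheory.measure_univ, smul_eq_mul, mul_one]
    rw [← ENNReal.ofReal_sum_of_nonneg (fun x _ => hp x), hp1, ENNReal.ofReal_one]
  have hb : ∀ᵐ x ∂μ, f x ∈ Set.Icc a b := by
    rw [MeasureTheory.ae_iff]
    simp only [μ, MeasureTheory.Measure.coe_finsetSum, Finset.sum_apply,
      MeasureTheory.Measure.smul_apply, smul_eq_mul]
    refine Finset.sum_eq_zero fun x _ => ?_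
    by_cases hx : p x = 0
    · simp [hx]
    · simp only [mul_eq_zero]
      right
      rw [MeasureTheory.Measure.dirac_apply' _ (by trivial)]
      simpa using hf x hx
  have key := (ProbabilityTheory.hasSubgaussianMGF_of_mem_Icc
    (measurable_from_top (f := f)).aemeasurable hb).mgf_le l
  rw [ProbabilityTheory.mgf, hμ, hμ, hc] at key
  refine key.trans (le_of_eq ?_)
  congr 1
  push_cast
  rw [div_pow, Real.norm_eq_abs, sq_abs]
  ring

theorem sum_prod_weight {α : Type*} [Fintype α] (K : ℕ) (w P g h : α → ℝ) :
    ∑ p : α × (Fin K → α), (w p.1 * ∏ k, P (p.2 k)) * (g p.1 * ∏ k, h (p.2 k)) =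
      (∑ x, w x * g x) * (∑ x, P x * h x) ^ K := by
  rw [Fintype.sum_pow, Finset.sum_mul_sum, Fintype.sum_prod_type]
  refine Finset.sum_congr rfl fun x _ => Finset.sum_congr rfl fun y _ => ?_
  rw [Finset.prod_mul_distrib]
  ring

/-- Conditional Hoeffding bound: the moment generating function of a variable observed only on
`D`, compensated on `D`, is at most `1`. -/
theorem sum_mul_ite_exp_le_one {α : Type*} [Fintype α] (P Y : α → ℝ) (D : α → Prop)
    [DecidablePred D] (a b c q l : ℝ) (hP : ∀ x, 0 ≤ P x) (hP1 : ∑ x, P x = 1) (hq : 0 < q)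
    (hY : ∀ x, D x → Y x ∈ Set.Icc a b) (hD : ∑ x, (if D x then P x else 0) = q)
    (hYc : ∑ x, (if D x then P x * Y x else 0) = q * c) :
    ∑ x, P x * (if D x then Real.exp (l * (Y x - c) - l ^ 2 * (b - a) ^ 2 / 8) else 1) ≤ 1 := by
  have key := sum_mul_exp_le_of_mem_Icc (fun x => (if D x then P x else 0) / q) Y a b c l
    (fun x => by have := hP x; split_ifs <;> positivity)
    (by rw [← Finset.sum_div, hD, div_self hq.ne'])
    (fun x hx => hY x (by by_contra h; simp [h] at hx))
    (by
      have : ∀ x, (if D x then P x else 0) / q * Y x = (if D x then P x * Y x else 0) / q := by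
        intro x; split_ifs <;> ring
      simp only [this]
      rw [← Finset.sum_div, hYc]; field_simp)
  have hsplit : ∀ x, P x * (if D x then Real.exp (l * (Y x - c) - l ^ 2 * (b - a) ^ 2 / 8) else 1)
      = (P x - (if D x then P x else 0)) + q * Real.exp (-(l ^ 2 * (b - a) ^ 2 / 8)) *
        ((if D x then P x else 0) / q * Real.exp (l * (Y x - c))) := by
    intro x
    split_ifs
    · rw [sub_eq_add_neg, Real.exp_add]; field_simp; ring
    · simp
  simp only [hsplit]
  rw [Finset.sum_add_distrib, Finset.sum_sub_distrib, ← Finset.mul_sum, hP1, hD]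
  have h2 : q * Real.exp (-(l ^ 2 * (b - a) ^ 2 / 8)) *
      ∑ x, ((if D x then P x else 0) / q * Real.exp (l * (Y x - c))) ≤ q := by
    refine (mul_le_mul_of_nonneg_left key (by positivity)).trans (le_of_eq ?_)
    rw [mul_assoc, ← Real.exp_add]; simp
  linarith

theorem one_le_add_exp_of_le_abs_average_sub {q t r c m k S : ℝ} {K M : ℕ} (hq : 0 ≤ q)
    (ht : 0 < t) (hr : 0 < r) (hm : m = 1 + k) (hk : 0 ≤ k) (hM : K * q / 2 < m → (M : ℝ) + 1 ≤ m)
    (h : t ≤ |S / m - c|) :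
    1 ≤ Real.exp (-(2 * q) * (k - K * q) - q ^ 2 * K) +
      Real.exp (-(2 * t ^ 2 / r ^ 2) * (M + 1)) *
        (Real.exp (4 * t / r ^ 2 * (S - m * c) - m * ((4 * t / r ^ 2) ^ 2 * r ^ 2 / 8)) +
         Real.exp (-(4 * t / r ^ 2) * (S - m * c) - m * ((-(4 * t / r ^ 2)) ^ 2 * r ^ 2 / 8))) := by
  have hm0 : 0 < m := by linarith
  rcases le_or_gt m (K * q / 2) with h1 | h1
  · have h2 : 1 ≤ Real.exp (-(2 * q) * (k - K * q) - q ^ 2 * K) := by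
      apply Real.one_le_exp
      have : 0 ≤ 2 * q * (K * q / 2 - k) := mul_nonneg (by positivity) (by linarith)
      linarith
    have : 0 ≤ Real.exp (-(2 * t ^ 2 / r ^ 2) * (M + 1)) *
        (Real.exp (4 * t / r ^ 2 * (S - m * c) - m * ((4 * t / r ^ 2) ^ 2 * r ^ 2 / 8)) +
         Real.exp (-(4 * t / r ^ 2) * (S - m * c) - m * ((-(4 * t / r ^ 2)) ^ 2 * r ^ 2 / 8))) := by
      positivity
    linarith
  · have hM' := hM h1
    have hcomp : ∀ d, t * m ≤ d →
        1 ≤ Real.exp (-(2 * t ^ 2 / r ^ 2) * (M + 1)) *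
          Real.exp (4 * t / r ^ 2 * d - m * ((4 * t / r ^ 2) ^ 2 * r ^ 2 / 8)) := by
      intro d hd
      rw [← Real.exp_add]
      apply Real.one_le_exp
      have e1 : m * ((4 * t / r ^ 2) ^ 2 * r ^ 2 / 8) = 2 * t ^ 2 / r ^ 2 * m := by
        field_simp; ring
      have e2 : 4 * t / r ^ 2 * (t * m) = 4 * t ^ 2 / r ^ 2 * m := by field_simp
      have e3 : 4 * t / r ^ 2 * (t * m) ≤ 4 * t / r ^ 2 * d :=
        mul_le_mul_of_nonneg_left hd (by positivity)
      have e4 : 2 * t ^ 2 / r ^ 2 * (M + 1) ≤ 2 * t ^ 2 / r ^ 2 * m :=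
        mul_le_mul_of_nonneg_left hM' (by positivity)
      have e5 : 4 * t ^ 2 / r ^ 2 * m = 2 * (2 * t ^ 2 / r ^ 2 * m) := by ring
      rw [e1]; linarith
    have hSm : S - m * c = (S / m - c) * m := by field_simp
    rw [mul_add]
    have p0 := Real.exp_pos (-(2 * q) * (k - K * q) - q ^ 2 * K)
    rcases le_abs.mp h with h2 | h2
    · have := hcomp (S - m * c) (by rw [hSm]; exact mul_le_mul_of_nonneg_right h2 hm0.le)
      have : 0 ≤ Real.exp (-(2 * t ^ 2 / r ^ 2) * (M + 1)) *
        Real.exp (-(4 * t / r ^ 2) * (S - m * c) - m * ((-(4 * t / r ^ 2)) ^ 2 * r ^ 2 / 8)) := by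
        positivity
      linarith
    · have h3 := hcomp (-(S - m * c))
        (by rw [hSm, ← neg_mul]; exact mul_le_mul_of_nonneg_right h2 hm0.le)
      rw [mul_neg, ← neg_mul] at h3
      rw [neg_sq]
      have : 0 ≤ Real.exp (-(2 * t ^ 2 / r ^ 2) * (M + 1)) *
        Real.exp (4 * t / r ^ 2 * (S - m * c) - m * ((4 * t / r ^ 2) ^ 2 * r ^ 2 / 8)) := by
        positivity
      linarith

/-- Deviation bound for the average of one warm-up sample and a random number of main samples,
namely those that fall into `D`. -/
theorem sum_weight_average_deviation_le {α : Type*} [Fintype α] (K M : ℕ) (w P X Y : α → ℝ)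
    (D : α → Prop) [DecidablePred D] (a b c q t : ℝ)
    (hw : ∀ x, 0 ≤ w x) (hw1 : ∑ x, w x = 1) (hP : ∀ x, 0 ≤ P x) (hP1 : ∑ x, P x = 1)
    (hq : 0 < q) (hX : ∀ x, w x ≠ 0 → X x ∈ Set.Icc a b) (hY : ∀ x, D x → Y x ∈ Set.Icc a b)
    (hXc : ∑ x, w x * X x = c) (hD : ∑ x, (if D x then P x else 0) = q)
    (hYc : ∑ x, (if D x then P x * Y x else 0) = q * c) (ht : 0 < t) (hab : 0 < b - a)
    (hM : ∀ m : ℕ, K * q / 2 < m → M + 1 ≤ m) (E : α × (Fin K → α) → Prop) [DecidablePred E]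
    (hE : ∀ p, E p → t ≤ |(X p.1 + ∑ k with D (p.2 k), Y (p.2 k)) /
      ((1 + #{k | D (p.2 k)} : ℕ) : ℝ) - c|) :
    ∑ p : α × (Fin K → α), (if E p then w p.1 * ∏ k, P (p.2 k) else 0) ≤
      Real.exp (-(K * q ^ 2 / 2)) + 2 * Real.exp (-(2 * t ^ 2 / (b - a) ^ 2) * (M + 1)) := by
  set r := b - a with hr
  set C := Real.exp (-(2 * t ^ 2 / r ^ 2) * (M + 1)) with hC
  set G : ℝ → α × (Fin K → α) → ℝ := fun l p =>
    Real.exp (l * (X p.1 - c) - l ^ 2 * r ^ 2 / 8) *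
      ∏ k, (if D (p.2 k) then Real.exp (l * (Y (p.2 k) - c) - l ^ 2 * r ^ 2 / 8) else 1) with hG
  set F : α × (Fin K → α) → ℝ := fun p =>
    Real.exp (-(q ^ 2 * K)) *
      ∏ k, Real.exp (-(2 * q) * ((if D (p.2 k) then 1 else 0) - q)) with hF
  have hGexp : ∀ l p, G l p = Real.exp (l * ((X p.1 + ∑ k with D (p.2 k), Y (p.2 k)) -
      ((1 + #{k | D (p.2 k)} : ℕ) : ℝ) * c) -
      ((1 + #{k | D (p.2 k)} : ℕ) : ℝ) * (l ^ 2 * r ^ 2 / 8)) := by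
    intro l p
    simp only [hG]
    rw [← Finset.prod_filter, ← Real.exp_sum, ← Real.exp_add]
    congr 1
    rw [Finset.sum_sub_distrib, ← Finset.mul_sum, Finset.sum_sub_distrib]
    simp only [Finset.sum_const, nsmul_eq_mul]
    push_cast
    ring
  have hFexp : ∀ p, F p = Real.exp (-(2 * q) * ((#{k | D (p.2 k)} : ℝ) - K * q) - q ^ 2 * K) := by
    intro p
    simp only [hF]
    rw [← Real.exp_sum, ← Real.exp_add, ← Finset.mul_sum, Finset.sum_sub_distrib, Finset.sum_boole]
    congr 1
    simp
    ring
  have hpt : ∀ p : α × (Fin K → α), (if E p then w p.1 * ∏ k, P (p.2 k) else 0) ≤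
      (w p.1 * ∏ k, P (p.2 k)) * F p + C * ((w p.1 * ∏ k, P (p.2 k)) * G (4 * t / r ^ 2) p) +
        C * ((w p.1 * ∏ k, P (p.2 k)) * G (-(4 * t / r ^ 2)) p) := by
    intro p
    have hW : 0 ≤ w p.1 * ∏ k, P (p.2 k) := mul_nonneg (hw _) (Finset.prod_nonneg fun k _ => hP _)
    have hC0 : 0 ≤ C := (Real.exp_pos _).le
    split_ifs with h
    · have key := one_le_add_exp_of_le_abs_average_sub (q := q) (t := t) (r := r) (K := K) (M := M)
        (k := (#{k | D (p.2 k)} : ℝ)) hq.le ht hab (by push_cast; rfl) (by positivity)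
        (fun h' => by exact_mod_cast hM _ h') (hE p h)
      rw [← hFexp, ← hGexp, ← hGexp, ← hC] at key
      nlinarith [mul_le_mul_of_nonneg_left key hW]
    · have h1 : 0 ≤ F p := by rw [hFexp]; positivity
      have h2 : ∀ l, 0 ≤ G l p := fun l => by rw [hGexp]; positivity
      have := h2 (4 * t / r ^ 2)
      have := h2 (-(4 * t / r ^ 2))
      positivity
  have hGsum : ∀ l, ∑ p : α × (Fin K → α), (w p.1 * ∏ k, P (p.2 k)) * G l p ≤ 1 := by
    intro l
    have h1 := sum_mul_exp_le_of_mem_Icc w X a b c l hw hw1 hX hXc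
    have h2 := sum_mul_ite_exp_le_one P Y D a b c q l hP hP1 hq hY hD hYc
    simp only [hG]
    rw [sum_prod_weight K w P (fun x => Real.exp (l * (X x - c) - l ^ 2 * r ^ 2 / 8))
      (fun x => if D x then Real.exp (l * (Y x - c) - l ^ 2 * r ^ 2 / 8) else 1)]
    refine mul_le_one₀ ?_ (pow_nonneg (Finset.sum_nonneg fun x _ => mul_nonneg (hP x) ?_) _)
      (pow_le_one₀ (Finset.sum_nonneg fun x _ => mul_nonneg (hP x) ?_) h2)
    · simp only [sub_eq_add_neg (_ * _) (_ / _), Real.exp_add, ← mul_assoc, ← Finset.sum_mul]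
      refine (mul_le_mul_of_nonneg_right h1 (Real.exp_pos _).le).trans ?_
      rw [← Real.exp_add]; simp [hr]
    · split_ifs <;> positivity
    · split_ifs <;> positivity
  have hFsum : ∑ p : α × (Fin K → α), (w p.1 * ∏ k, P (p.2 k)) * F p ≤
      Real.exp (-(K * q ^ 2 / 2)) := by
    have h1 := sum_mul_exp_le_of_mem_Icc P (fun x => if D x then (1 : ℝ) else 0) 0 1 q (-(2 * q))
      hP hP1 (fun x _ => by split_ifs <;> simp) (by simpa using hD)
    simp only [hF]
    rw [sum_prod_weight K w P (fun _ => Real.exp (-(q ^ 2 * K)))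
      (fun x => Real.exp (-(2 * q) * ((if D x then 1 else 0) - q))), ← Finset.sum_mul, hw1, one_mul]
    refine (mul_le_mul_of_nonneg_left (pow_le_pow_left₀ (Finset.sum_nonneg fun x _ =>
      mul_nonneg (hP x) (Real.exp_pos _).le) h1 K) (Real.exp_pos _).le).trans (le_of_eq ?_)
    rw [← Real.exp_nat_mul, ← Real.exp_add]
    congr 1
    ring
  refine (Finset.sum_le_sum fun p _ => hpt p).trans ?_
  rw [Finset.sum_add_distrib, Finset.sum_add_distrib, ← Finset.mul_sum, ← Finset.mul_sum]
  have hC0 : 0 ≤ C := (Real.exp_pos _).le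
  have h1 := mul_le_mul_of_nonneg_left (hGsum (4 * t / r ^ 2)) hC0
  have h2 := mul_le_mul_of_nonneg_left (hGsum (-(4 * t / r ^ 2))) hC0
  linarith

theorem abs_average_sub_le {α ι : Type*} (T : Finset ι) (x a b c : ℝ) (Y : α → ℝ) (A : ι → α)
    (hx : x ∈ Set.Icc a b) (hc : c ∈ Set.Icc a b) (hY : ∀ k ∈ T, Y (A k) ∈ Set.Icc a b) :
    |(x + ∑ k ∈ T, Y (A k)) / ((1 + #T : ℕ) : ℝ) - c| ≤ b - a := by
  have hpos : (0 : ℝ) < ((1 + #T : ℕ) : ℝ) := by positivity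
  have h1 : ∑ k ∈ T, Y (A k) ≤ #T * b := by
    simpa using Finset.sum_le_card_nsmul T (fun k => Y (A k)) b fun k hk => (hY k hk).2
  have h2 : #T * a ≤ ∑ k ∈ T, Y (A k) := by
    simpa using Finset.card_nsmul_le_sum T (fun k => Y (A k)) a fun k hk => (hY k hk).1
  have h3 : (x + ∑ k ∈ T, Y (A k)) / ((1 + #T : ℕ) : ℝ) ≤ b := by
    rw [div_le_iff₀ hpos]; push_cast; linarith [hx.2]
  have h4 : a ≤ (x + ∑ k ∈ T, Y (A k)) / ((1 + #T : ℕ) : ℝ) := by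
    rw [le_div_iff₀ hpos]; push_cast; linarith [hx.1]
  rw [abs_le]
  constructor <;> linarith [hc.1, hc.2]

theorem sum_mul_mem_Icc {α : Type*} [Fintype α] (w X : α → ℝ) (a b : ℝ) (hw : ∀ x, 0 ≤ w x)
    (hw1 : ∑ x, w x = 1) (hX : ∀ x, w x ≠ 0 → X x ∈ Set.Icc a b) :
    ∑ x, w x * X x ∈ Set.Icc a b := by
  have key : ∀ x, w x * a ≤ w x * X x ∧ w x * X x ≤ w x * b := by
    intro x
    by_cases h : w x = 0
    · simp [h]
    · exact ⟨mul_le_mul_of_nonneg_left (hX x h).1 (hw x),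
        mul_le_mul_of_nonneg_left (hX x h).2 (hw x)⟩
  constructor
  · calc a = ∑ x, w x * a := by rw [← Finset.sum_mul, hw1, one_mul]
      _ ≤ _ := Finset.sum_le_sum fun x _ => (key x).1
  · calc _ ≤ ∑ x, w x * b := Finset.sum_le_sum fun x _ => (key x).2
      _ = b := by rw [← Finset.sum_mul, hw1, one_mul]

theorem sum_quadruple_mul {α β γ δ : Type*} [Fintype α] [Fintype β] [Fintype γ] [Fintype δ]
    (f : α × γ → ℝ) (g : β × δ → ℝ) :
    ∑ ω : α × β × γ × δ, f (ω.1, ω.2.2.1) * g (ω.2.1, ω.2.2.2) = (∑ p, f p) * ∑ p, g p := by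
  rw [Finset.sum_mul_sum, ← Fintype.sum_prod_type' (fun p r => f p * g r)]
  exact Fintype.sum_equiv ⟨fun ω => ((ω.1, ω.2.2.1), (ω.2.1, ω.2.2.2)),
    fun p => (p.1.1, p.2.1, p.1.2, p.2.2), fun _ => rfl, fun _ => rfl⟩ _ _ fun _ => rfl

theorem harm_pos {n : ℕ} (hn : 1 ≤ n) : 0 < harm n :=
  Finset.sum_pos (fun k _ => by positivity) (by simpa using Nat.one_le_iff_ne_zero.mp hn)

theorem wgt_nonneg (n : ℕ) (S : Finset (Fin n)) : 0 ≤ wgt n S := by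
  unfold wgt; positivity

theorem mem_Ni_powerset {n : ℕ} {i : Fin n} {S : Finset (Fin n)} : S ⊆ Ni n i ↔ i ∉ S := by
  simp [Ni, Finset.subset_erase]

theorem card_lt_of_notMem {n : ℕ} {i : Fin n} {S : Finset (Fin n)} (h : i ∉ S) : #S < n := by
  simpa using Finset.card_lt_univ_of_notMem h

theorem sum_wgt {n : ℕ} (hn : 1 ≤ n) (i : Fin n) :
    ∑ S, (if S ⊆ Ni n i then wgt n S else 0) = 1 := by
  have hfilter : (Finset.univ.filter fun S => S ⊆ Ni n i) = (Ni n i).powerset := by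
    ext S; simp
  have hcard : #(Ni n i) = n - 1 := by simp [Ni]
  rw [← Finset.sum_filter, hfilter]
  simp only [wgt]
  rw [Finset.sum_powerset_apply_card (fun k => 1 / ((n : ℝ) * ((n - 1).choose k : ℝ))), hcard]
  have hn' : (n : ℝ) ≠ 0 := by positivity
  have hterm : ∀ k ∈ Finset.range (n - 1 + 1),
      (n - 1).choose k • (1 / ((n : ℝ) * ((n - 1).choose k : ℝ))) = 1 / (n : ℝ) := by
    intro k hk
    have : ((n - 1).choose k : ℝ) ≠ 0 := by
      exact_mod_cast (Nat.choose_pos (Nat.lt_succ_iff.mp (Finset.mem_range.mp hk))).ne'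
    rw [nsmul_eq_mul]; field_simp
  rw [Finset.sum_congr rfl hterm, Finset.sum_const, Finset.card_range,
    Nat.sub_add_cancel hn, nsmul_eq_mul, mul_one_div_cancel hn']

theorem sum_Pplus {n : ℕ} (hn : 1 ≤ n) : ∑ S, Pplus n S = 1 := by
  rw [← Finset.powerset_univ]
  simp only [Pplus]
  rw [Finset.sum_powerset_apply_card (fun k => 1 / ((k : ℝ) * (n.choose k : ℝ) * harm n)),
    Finset.card_univ, Fintype.card_fin, Finset.sum_range_succ']
  have hH := (harm_pos hn).ne'
  rw [Finset.sum_congr rfl (g := fun k : ℕ => 1 / ((k : ℝ) + 1) * (1 / harm n)),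
    ← Finset.sum_mul, ← harm]
  · simp [hH]
  · intro k hk
    have : (n.choose (k + 1) : ℝ) ≠ 0 := by
      exact_mod_cast (Nat.choose_pos (Finset.mem_range.mp hk)).ne'
    rw [nsmul_eq_mul]; push_cast; field_simp

theorem Pminus_compl {n : ℕ} (S : Finset (Fin n)) : Pminus n Sᶜ = Pplus n S := by
  have h : #S ≤ n := by simpa using Finset.card_le_univ S
  unfold Pminus Pplus
  rw [Finset.card_compl, Fintype.card_fin, Nat.choose_symm h, Nat.cast_sub h, sub_sub_cancel]

theorem sum_Pminus {n : ℕ} (hn : 1 ≤ n) : ∑ S, Pminus n S = 1 := by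
  rw [← sum_Pplus hn, ← Equiv.sum_comp (Function.Involutive.toPerm _ (compl_involutive (α := Finset (Fin n))))]
  exact Finset.sum_congr rfl fun S _ => Pminus_compl S

theorem Pplus_nonneg {n : ℕ} (hn : 1 ≤ n) (S : Finset (Fin n)) : 0 ≤ Pplus n S := by
  have := harm_pos hn
  unfold Pplus; positivity

theorem Pminus_nonneg {n : ℕ} (hn : 1 ≤ n) (S : Finset (Fin n)) : 0 ≤ Pminus n S := by
  rw [← compl_compl S, Pminus_compl]; exact Pplus_nonneg hn _

theorem Pminus_eq_wgt {n : ℕ} {i : Fin n} {S : Finset (Fin n)} (h : i ∉ S) :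
    Pminus n S = 1 / harm n * wgt n S := by
  have hS := card_lt_of_notMem h
  unfold Pminus wgt
  obtain ⟨m, rfl⟩ : ∃ m, n = m + 1 := ⟨n - 1, by omega⟩
  have key := Nat.choose_mul_succ_eq m #S
  have key' : ((m + 1 : ℕ) : ℝ) * (m.choose #S : ℝ) =
      (((m + 1 : ℕ) : ℝ) - (#S : ℝ)) * ((m + 1).choose #S : ℝ) := by
    rw [← Nat.cast_sub hS.le]
    exact_mod_cast (by linarith : (m + 1) * m.choose #S = (m + 1 - #S) * (m + 1).choose #S)
  rw [← key', Nat.add_sub_cancel, one_div_mul_one_div, mul_comm (harm _)]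

theorem Pplus_insert_eq_wgt {n : ℕ} {i : Fin n} {S : Finset (Fin n)} (h : i ∉ S) :
    Pplus n (insert i S) = 1 / harm n * wgt n S := by
  have hS := card_lt_of_notMem h
  unfold Pplus wgt
  rw [Finset.card_insert_of_notMem h]
  obtain ⟨m, rfl⟩ : ∃ m, n = m + 1 := ⟨n - 1, by omega⟩
  have key := Nat.add_one_mul_choose_eq m #S
  have key' : ((m + 1 : ℕ) : ℝ) * (m.choose #S : ℝ) =
      ((#S + 1 : ℕ) : ℝ) * ((m + 1).choose (#S + 1) : ℝ) := by
    exact_mod_cast (by linarith : (m + 1) * m.choose #S = (#S + 1) * (m + 1).choose (#S + 1))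
  rw [← key', Nat.add_sub_cancel, one_div_mul_one_div, mul_comm (harm _)]

theorem sum_mem_eq_sum_insert {n : ℕ} (i : Fin n) (g : Finset (Fin n) → ℝ) :
    ∑ S, (if i ∈ S then g S else 0) = ∑ S, (if S ⊆ Ni n i then g (insert i S) else 0) := by
  rw [← Finset.sum_filter, ← Finset.sum_filter]
  refine Finset.sum_nbij' (fun S => S.erase i) (fun S => insert i S) ?_ ?_ ?_ ?_ ?_
  · intro S _; simp [mem_Ni_powerset]
  · intro S _; simp
  · intro S hS; simpa using Finset.insert_erase (by simpa using hS)
  · intro S hS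
    simp only [Finset.mem_filter, mem_Ni_powerset] at hS
    exact Finset.erase_insert hS.2
  · intro S hS
    simp only [Finset.mem_filter] at hS
    rw [Finset.insert_erase hS.2]

theorem sum_powerset_Ni {n : ℕ} (i : Fin n) (X : Finset (Fin n) → ℝ) :
    ∑ S, (if S ⊆ Ni n i then wgt n S else 0) * X S = ∑ S ∈ (Ni n i).powerset, wgt n S * X S := by
  have hfilter : (Finset.univ.filter fun S => S ⊆ Ni n i) = (Ni n i).powerset := by
    ext S; simp
  rw [← hfilter, Finset.sum_filter]
  exact Finset.sum_congr rfl fun S _ => by split_ifs <;> simp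

theorem sum_mem_Pplus_mul {n : ℕ} (i : Fin n) (Y : Finset (Fin n) → ℝ) :
    ∑ S, (if i ∈ S then Pplus n S * Y S else 0) =
      1 / harm n * ∑ S, (if S ⊆ Ni n i then wgt n S else 0) * Y (insert i S) := by
  rw [sum_mem_eq_sum_insert i (fun S => Pplus n S * Y S), Finset.mul_sum]
  refine Finset.sum_congr rfl fun S _ => ?_
  split_ifs with h
  · rw [Pplus_insert_eq_wgt (mem_Ni_powerset.mp h)]; ring
  · simp

theorem sum_notMem_Pminus_mul {n : ℕ} (i : Fin n) (Y : Finset (Fin n) → ℝ) :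
    ∑ S, (if i ∉ S then Pminus n S * Y S else 0) =
      1 / harm n * ∑ S, (if S ⊆ Ni n i then wgt n S else 0) * Y S := by
  rw [Finset.mul_sum]
  refine Finset.sum_congr rfl fun S _ => ?_
  by_cases h : i ∈ S
  · simp [mem_Ni_powerset, h]
  · simp only [mem_Ni_powerset, h, not_false_eq_true, if_true]
    rw [Pminus_eq_wgt h]; ring

theorem sum_mem_Pplus {n : ℕ} (hn : 1 ≤ n) (i : Fin n) :
    ∑ S, (if i ∈ S then Pplus n S else 0) = 1 / harm n := by
  simpa only [mul_one, sum_wgt hn i] using sum_mem_Pplus_mul i (fun _ => 1)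

theorem sum_notMem_Pminus {n : ℕ} (hn : 1 ≤ n) (i : Fin n) :
    ∑ S, (if i ∉ S then Pminus n S else 0) = 1 / harm n := by
  simpa only [mul_one, sum_wgt hn i] using sum_notMem_Pminus_mul i (fun _ => 1)

theorem exists_side_deviation {d₁ d₂ r₁ r₂ ε : ℝ} (hε : 0 < ε) (h₁ : |d₁| ≤ r₁) (h₂ : |d₂| ≤ r₂)
    (hr : 0 < r₁ + r₂) (h : ε ≤ |d₁ - d₂|) :
    (0 < r₁ ∧ ε / (r₁ + r₂) * r₁ ≤ |d₁|) ∨ (0 < r₂ ∧ ε / (r₁ + r₂) * r₂ ≤ |d₂|) := by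
  by_contra! hcon
  obtain ⟨c1, c2⟩ := hcon
  have h3 : ε ≤ |d₁| + |d₂| := h.trans (abs_sub d₁ d₂)
  have h4 : ε / (r₁ + r₂) * r₁ + ε / (r₁ + r₂) * r₂ = ε := by field_simp
  have a1 := (abs_nonneg d₁).trans h₁
  have a2 := (abs_nonneg d₂).trans h₂
  rcases a1.eq_or_lt with b1 | b1 <;> rcases a2.eq_or_lt with b2 | b2
  · linarith
  · have := c2 b2; rw [← b1] at h4 h₁ this; linarith
  · have := c1 b1; rw [← b2] at h4 h₂ this; linarith
  · linarith [c1 b1, c2 b2]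

/-- Theorem 4.5: with `T̄ = 2K` and `Ψ = 2ε²/(r_i⁺ + r_i⁻)²`,
`P(|φ̂_i − φ_i| ≥ ε) ≤ 2·exp(−T̄/(4Hₙ²)) + 4·exp(−Ψ·⌊T̄/(4Hₙ)⌋)/(exp(Ψ) − 1)`. -/
theorem stmt14 (n K : ℕ) (hn : 1 ≤ n) (hK : 1 ≤ K) (ν : Finset (Fin n) → ℝ)
    (hν : ν ∅ = 0) (i : Fin n) (ε : ℝ) (hε : 0 < ε)
    (hr : 0 < rplus n ν i + rminus n ν i) :
    probEvent n K i (fun ω => ε ≤ |phiHat n K ν i ω - shapley n ν i|)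
      ≤ 2 * Real.exp (-(2 * (K : ℝ)) / (4 * (harm n) ^ 2)) +
        4 * Real.exp (-(2 * ε ^ 2 / (rplus n ν i + rminus n ν i) ^ 2) *
              ((⌊(2 * (K : ℝ)) / (4 * harm n)⌋ : ℤ) : ℝ)) /
          (Real.exp (2 * ε ^ 2 / (rplus n ν i + rminus n ν i) ^ 2) - 1) := by
  set r := rplus n ν i + rminus n ν i
  have hne : (Ni n i).powerset.Nonempty := ⟨∅, Finset.empty_mem_powerset _⟩
  have hH := harm_pos hn
  set q := 1 / harm n with hq_def
  have hq : 0 < q := by positivity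
  set s := ε / r with hs_def
  have hs : 0 < s := by positivity
  have hx : (2 * (K : ℝ)) / (4 * harm n) = K * q / 2 := by rw [hq_def]; field_simp; norm_num
  set M := ⌊K * q / 2⌋₊
  have hM : ∀ m : ℕ, K * q / 2 < m → M + 1 ≤ m := fun m hm =>
    (Nat.floor_lt (by positivity)).mpr hm
  set w : Finset (Fin n) → ℝ := fun S => if S ⊆ Ni n i then wgt n S else 0 with hw_def
  have hw : ∀ S, 0 ≤ w S := fun S => by
    simp only [hw_def]; split_ifs <;> simp [wgt_nonneg]
  have hw1 : ∑ S, w S = 1 := sum_wgt hn i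
  have hwmem : ∀ S, w S ≠ 0 → i ∉ S := fun S hS => by
    by_contra h; exact hS (by simp [hw_def, mem_Ni_powerset, h])
  set X : Finset (Fin n) → ℝ := fun S => ν (insert i S) with hX_def
  set a₁ := (Ni n i).powerset.inf' hne X
  set b₁ := (Ni n i).powerset.sup' hne X
  set a₂ := (Ni n i).powerset.inf' hne ν
  set b₂ := (Ni n i).powerset.sup' hne ν
  have hX : ∀ S, i ∉ S → X S ∈ Set.Icc a₁ b₁ := fun S h =>
    have hS := Finset.mem_powerset.mpr (mem_Ni_powerset.mpr h)
    ⟨Finset.inf'_le X hS, Finset.le_sup' X hS⟩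
  have hν₁ : ∀ S, i ∈ S → ν S ∈ Set.Icc a₁ b₁ := fun S h => by
    have := hX (S.erase i) (by simp)
    simpa only [hX_def, Finset.insert_erase h] using this
  have hν₂ : ∀ S, i ∉ S → ν S ∈ Set.Icc a₂ b₂ := fun S h =>
    have hS := Finset.mem_powerset.mpr (mem_Ni_powerset.mpr h)
    ⟨Finset.inf'_le ν hS, Finset.le_sup' ν hS⟩
  set c₁ := ∑ S, w S * X S with hc₁
  set c₂ := ∑ S, w S * ν S with hc₂
  have hshap : shapley n ν i = c₁ - c₂ := by
    rw [hc₁, hc₂, sum_powerset_Ni, sum_powerset_Ni, ← Finset.sum_sub_distrib]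
    exact Finset.sum_congr rfl fun S _ => mul_sub _ _ _
  set W₁ : Finset (Fin n) × (Fin K → Finset (Fin n)) → ℝ :=
    fun p => w p.1 * ∏ k, Pplus n (p.2 k) with hW₁
  set W₂ : Finset (Fin n) × (Fin K → Finset (Fin n)) → ℝ :=
    fun p => w p.1 * ∏ k, Pminus n (p.2 k) with hW₂
  have hW₁0 : ∀ p, 0 ≤ W₁ p := fun p =>
    mul_nonneg (hw _) (Finset.prod_nonneg fun _ _ => Pplus_nonneg hn _)
  have hW₂0 : ∀ p, 0 ≤ W₂ p := fun p =>
    mul_nonneg (hw _) (Finset.prod_nonneg fun _ _ => Pminus_nonneg hn _)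
  have hW₁1 : ∑ p, W₁ p = 1 := by
    have := sum_prod_weight K w (Pplus n) (fun _ => 1) (fun _ => 1)
    simpa [hw1, sum_Pplus hn] using this
  have hW₂1 : ∑ p, W₂ p = 1 := by
    have := sum_prod_weight K w (Pminus n) (fun _ => 1) (fun _ => 1)
    simpa [hw1, sum_Pminus hn] using this
  have hjoint : ∀ ω, jointP n K i ω = W₁ (ω.1, ω.2.2.1) * W₂ (ω.2.1, ω.2.2.2) := fun ω => by
    simp only [jointP, hW₁, hW₂, hw_def]; ring
  set d₁ : Finset (Fin n) × (Fin K → Finset (Fin n)) → ℝ := fun p =>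
    (X p.1 + ∑ k with i ∈ p.2 k, ν (p.2 k)) / ((1 + #{k | i ∈ p.2 k} : ℕ) : ℝ) - c₁ with hd₁
  set d₂ : Finset (Fin n) × (Fin K → Finset (Fin n)) → ℝ := fun p =>
    (ν p.1 + ∑ k with i ∉ p.2 k, ν (p.2 k)) / ((1 + #{k | i ∉ p.2 k} : ℕ) : ℝ) - c₂ with hd₂
  have hdiff : ∀ ω, phiHat n K ν i ω - shapley n ν i =
      d₁ (ω.1, ω.2.2.1) - d₂ (ω.2.1, ω.2.2.2) := fun ω => by
    rw [hshap]
    simp only [phiHat, phiHatPlus, phiHatMinus, mplus, mminus, hd₁, hd₂, hX_def]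
    ring
  set f₁ : Finset (Fin n) × (Fin K → Finset (Fin n)) → ℝ := fun p =>
    if 0 < b₁ - a₁ ∧ s * (b₁ - a₁) ≤ |d₁ p| then W₁ p else 0 with hf₁
  set f₂ : Finset (Fin n) × (Fin K → Finset (Fin n)) → ℝ := fun p =>
    if 0 < b₂ - a₂ ∧ s * (b₂ - a₂) ≤ |d₂ p| then W₂ p else 0 with hf₂
  set B := Real.exp (-(K * q ^ 2 / 2)) + 2 * Real.exp (-(2 * s ^ 2) * (M + 1)) with hB
  have hB0 : 0 ≤ B := by positivity
  have hB₁ : ∑ p, f₁ p ≤ B := by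
    by_cases h : 0 < b₁ - a₁
    · have key := sum_weight_average_deviation_le K M w (Pplus n) X ν (fun S => i ∈ S) a₁ b₁ c₁ q
        (s * (b₁ - a₁)) hw hw1 (Pplus_nonneg hn) (sum_Pplus hn) hq (fun S hS => hX S (hwmem S hS))
        hν₁ rfl (sum_mem_Pplus hn i)
        (sum_mem_Pplus_mul i ν) (by positivity) h hM
        (fun p => 0 < b₁ - a₁ ∧ s * (b₁ - a₁) ≤ |d₁ p|) (fun p hp => hp.2)
      have e : 2 * (s * (b₁ - a₁)) ^ 2 / (b₁ - a₁) ^ 2 = 2 * s ^ 2 := by field_simp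
      rw [e] at key
      exact key
    · simpa [hf₁, h] using hB0
  have hB₂ : ∑ p, f₂ p ≤ B := by
    by_cases h : 0 < b₂ - a₂
    · have key := sum_weight_average_deviation_le K M w (Pminus n) ν ν (fun S => i ∉ S) a₂ b₂ c₂ q
        (s * (b₂ - a₂)) hw hw1 (Pminus_nonneg hn) (sum_Pminus hn) hq
        (fun S hS => hν₂ S (hwmem S hS)) hν₂ rfl
        (sum_notMem_Pminus hn i)
        (sum_notMem_Pminus_mul i ν) (by positivity) h hM
        (fun p => 0 < b₂ - a₂ ∧ s * (b₂ - a₂) ≤ |d₂ p|) (fun p hp => hp.2)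
      have e : 2 * (s * (b₂ - a₂)) ^ 2 / (b₂ - a₂) ^ 2 = 2 * s ^ 2 := by field_simp
      rw [e] at key
      exact key
    · simpa [hf₂, h] using hB0
  have hprob : probEvent n K i (fun ω => ε ≤ |phiHat n K ν i ω - shapley n ν i|) ≤ B + B := by
    have hpt : ∀ ω : Omega n K, (if ε ≤ |phiHat n K ν i ω - shapley n ν i| then
        jointP n K i ω else 0) ≤ f₁ (ω.1, ω.2.2.1) * W₂ (ω.2.1, ω.2.2.2) +
          W₁ (ω.1, ω.2.2.1) * f₂ (ω.2.1, ω.2.2.2) := by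
      intro ω
      have p1 := hW₁0 (ω.1, ω.2.2.1)
      have p2 := hW₂0 (ω.2.1, ω.2.2.2)
      have q1 : 0 ≤ f₁ (ω.1, ω.2.2.1) := by simp only [hf₁]; split_ifs <;> simp [p1]
      have q2 : 0 ≤ f₂ (ω.2.1, ω.2.2.2) := by simp only [hf₂]; split_ifs <;> simp [p2]
      have hsum := add_nonneg (mul_nonneg q1 p2) (mul_nonneg p1 q2)
      split_ifs with h
      · rw [hjoint]
        by_cases h1 : w ω.1 = 0
        · have : W₁ (ω.1, ω.2.2.1) = 0 := by simp [hW₁, h1]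
          exact le_of_eq_of_le (by rw [this, zero_mul]) hsum
        by_cases h2 : w ω.2.1 = 0
        · have : W₂ (ω.2.1, ω.2.2.2) = 0 := by simp [hW₂, h2]
          exact le_of_eq_of_le (by rw [this, mul_zero]) hsum
        rw [hdiff] at h
        have k1 : |d₁ (ω.1, ω.2.2.1)| ≤ b₁ - a₁ :=
          abs_average_sub_le _ _ _ _ _ ν _ (hX _ (hwmem _ h1))
            (sum_mul_mem_Icc w X _ _ hw hw1 fun S hS => hX S (hwmem S hS))
            (fun k hk => hν₁ _ (by simpa using hk))
        have k2 : |d₂ (ω.2.1, ω.2.2.2)| ≤ b₂ - a₂ :=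
          abs_average_sub_le _ _ _ _ _ ν _ (hν₂ _ (hwmem _ h2))
            (sum_mul_mem_Icc w ν _ _ hw hw1 fun S hS => hν₂ S (hwmem S hS))
            (fun k hk => hν₂ _ (by simpa using hk))
        rcases exists_side_deviation hε k1 k2 hr h with h3 | h3
        · have : f₁ (ω.1, ω.2.2.1) = W₁ (ω.1, ω.2.2.1) := if_pos h3
          rw [this]
          linarith [mul_nonneg p1 q2]
        · have : f₂ (ω.2.1, ω.2.2.2) = W₂ (ω.2.1, ω.2.2.2) := if_pos h3
          rw [this]
          linarith [mul_nonneg q1 p2]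
      · exact hsum
    refine (Finset.sum_le_sum fun ω _ => hpt ω).trans ?_
    rw [Finset.sum_add_distrib, sum_quadruple_mul f₁ W₂, sum_quadruple_mul W₁ f₂, hW₁1, hW₂1]
    linarith
  refine hprob.trans ?_
  have e1 : -(2 * (K : ℝ)) / (4 * harm n ^ 2) = -(K * q ^ 2 / 2) := by
    rw [hq_def]; field_simp; norm_num
  have e2 : 2 * ε ^ 2 / r ^ 2 = 2 * s ^ 2 := by rw [hs_def, div_pow]; ring
  have e3 : ((⌊K * q / 2⌋ : ℤ) : ℝ) = M := (natCast_floor_eq_intCast_floor (by positivity)).symm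
  rw [e1, e2, hx, e3, hB]
  have hpos : 0 < Real.exp (2 * s ^ 2) - 1 := by
    have := Real.add_one_lt_exp (x := 2 * s ^ 2) (by positivity)
    have : 0 < 2 * s ^ 2 := by positivity
    linarith
  have hgeom : Real.exp (-(2 * s ^ 2) * (M + 1)) ≤
      Real.exp (-(2 * s ^ 2) * M) / (Real.exp (2 * s ^ 2) - 1) := by
    rw [le_div_iff₀ hpos, mul_sub, ← Real.exp_add, mul_one,
      show -(2 * s ^ 2) * ((M : ℝ) + 1) + 2 * s ^ 2 = -(2 * s ^ 2) * M by ring]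
    linarith [Real.exp_pos (-(2 * s ^ 2) * ((M : ℝ) + 1))]
  rw [mul_div_assoc (4 : ℝ)]
  linarith
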